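/- Let K be an algebraically closed field of characteristic 0 and g a finite-dimensional Lie algebra over K with nondegenerate Killing form. Suppose g = h ⊕ m is a direct sum decomposition into subspaces with ⁅h,h⁆ ⊆ h, ⁅h,m⁆ ⊆ m and ⁅m,m⁆ ⊆ h, and let H ⊆ h be a Cartan subalgebra of g. Then for every root α of (g, H), the root space g_α is entirely contained in h or entirely contained in m (i.e. every root is either compact or non-compact). -/

import Mathlib

open LieAlgebra LieModule

/-- Let `g` be a finite-dimensional Lie algebra over an algebraically closed field of
characteristic zero with nondegenerate Killing form, suppose `g = h ⊕ m` with `⁅h,h⁆ ⊆ h`,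
`⁅h,m⁆ ⊆ m`, `⁅m,m⁆ ⊆ h`, and let `H ⊆ h` be a Cartan subalgebra of `g`.  Then every root space
is entirely contained in `h` or entirely contained in `m`: every root is compact or
non-compact. -/
theorem rootSpace_subset_h_or_m
    {K : Type*} [Field K] [IsAlgClosed K] [CharZero K]
    {g : Type*} [LieRing g] [LieAlgebra K g] [FiniteDimensional K g]
    [LieAlgebra.IsKilling K g]
    (h m : Submodule K g) (hcompl : IsCompl h m)
    (hhh : ∀ x ∈ h, ∀ y ∈ h, ⁅x, y⁆ ∈ h)
    (hhm : ∀ x ∈ h, ∀ y ∈ m, ⁅x, y⁆ ∈ m)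
    (hmm : ∀ x ∈ m, ∀ y ∈ m, ⁅x, y⁆ ∈ h)
    (H : LieSubalgebra K g) [H.IsCartanSubalgebra]
    (hHh : (H : Submodule K g) ≤ h) :
    ∀ α : Weight K H g, α.IsNonZero →
      (∀ x ∈ rootSpace H (⇑α : H → K), x ∈ h) ∨
      (∀ x ∈ rootSpace H (⇑α : H → K), x ∈ m) := by
  intro α hα
  by_cases hall : ∀ x ∈ rootSpace H (⇑α : H → K), x ∈ h
  · exact Or.inl hall
  right
  push Not at hall
  obtain ⟨x, hx, hxh⟩ := hall
  have hxt : x ∈ h ⊔ m := by rw [hcompl.sup_eq_top]; trivial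
  obtain ⟨a, ha, b, hb, hab⟩ := Submodule.mem_sup.mp hxt
  have hb0 : b ≠ 0 := by
    rintro rfl
    exact hxh (by rw [← hab, add_zero]; exact ha)
  have hbw : b ∈ rootSpace H (⇑α : H → K) := by
    apply weightSpace_le_genWeightSpace g (⇑α : H → K)
    rw [mem_weightSpace]
    intro t
    have h1 : ⁅(t : g), x⁆ = α t • x := IsKilling.lie_eq_smul_of_mem_rootSpace hx t
    have ht : (t : g) ∈ h := hHh t.2
    have h2 : ⁅(t : g), b⁆ - α t • b = α t • a - ⁅(t : g), a⁆ := by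
      rw [← hab, lie_add, smul_add] at h1
      rw [sub_eq_sub_iff_add_eq_add, add_comm, h1]
    have hm' : ⁅(t : g), b⁆ - α t • b ∈ m := m.sub_mem (hhm _ ht _ hb) (m.smul_mem _ hb)
    have hh' : ⁅(t : g), b⁆ - α t • b ∈ h := by
      rw [h2]
      exact h.sub_mem (h.smul_mem _ ha) (hhh _ ht _ ha)
    exact sub_eq_zero.mp (Submodule.disjoint_def.mp hcompl.disjoint _ hh' hm')
  intro y hy
  obtain ⟨c, hc⟩ := (finrank_eq_one_iff_of_nonzero' (⟨b, hbw⟩ : rootSpace H (⇑α : H → K))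
    (by simpa using hb0)).mp (IsKilling.finrank_rootSpace_eq_one α hα) ⟨y, hy⟩
  have hc' : c • b = y := congrArg Subtype.val hc
  rw [← hc']
  exact m.smul_mem _ hb
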